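/- Let L_4 denote Craig's integral representation of S_4 of rank 3 (the case n = 4, d = 4), and identify ℤ[L_4] with ℤ[x, y, z]. Then ℤ[L_4]^{S_4} = ℤ[f, g, h] is a polynomial ring, where f := 6x² + 8xy + 3y² + 4xz + 3yz + z², g := 8x³ + 16x²y + 10xy² + 2y³ + 8x²z + 10xyz + 3y²z + 2xz² + yz², and h := 3x⁴ + 8x³y + 7x²y² + 2xy³ + 4x³z + 7x²yz + 3xy²z + x²z² + xyz², and f, g, h are algebraically independent over ℤ. -/

import Mathlib

set_option synthInstance.maxHeartbeats 1000000
set_option maxHeartbeats 1000000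

open MvPolynomial

/-- The `(n-1) × (n-1)` rational matrix `E^{i,j}` (1-based indices `i`, `j`) whose
`(i,j)`-entry is `1` and all other entries are `0`; it is the zero matrix when `i` or `j`
is out of the range `1, …, n-1`. -/
def Emat (n i j : ℕ) : Matrix (Fin (n - 1)) (Fin (n - 1)) ℚ :=
  Matrix.of fun a b => if (a : ℕ) + 1 = i ∧ (b : ℕ) + 1 = j then 1 else 0

/-- `F_k = I_{n-1} + E^{n-k-1,n-k} - 2 E^{n-k,n-k} + E^{n-k+1,n-k}`. -/
def Fmat (n k : ℕ) : Matrix (Fin (n - 1)) (Fin (n - 1)) ℚ :=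
  1 + Emat n (n - k - 1) (n - k) - 2 • Emat n (n - k) (n - k) + Emat n (n - k + 1) (n - k)

/-- `V_d = d E^{1,1} + ∑_{i=2}^{n-1} (E^{i,i} + (n-i) E^{1,i})`. -/
def Vmat (n d : ℕ) : Matrix (Fin (n - 1)) (Fin (n - 1)) ℚ :=
  d • Emat n 1 1 + ∑ i ∈ Finset.Icc 2 (n - 1), (Emat n i i + (n - i) • Emat n 1 i)

/-- The image of Craig's representation `L_d` of `S_n`: the subgroup of `GL_{n-1}(ℚ)`
generated by the images `V_d⁻¹ F_k V_d` of the adjacent transpositions `(k, k+1)`. -/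
noncomputable def craigGroup (n d : ℕ) : Subgroup (GL (Fin (n - 1)) ℚ) :=
  Subgroup.closure {g | ∃ k, 1 ≤ k ∧ k ≤ n - 1 ∧
    (g : Matrix (Fin (n - 1)) (Fin (n - 1)) ℚ) = (Vmat n d)⁻¹ * Fmat n k * Vmat n d}

/-- The algebra endomorphism of `ℚ[x_1, …, x_m]` given by the linear substitution
`x_i ↦ ∑_j M_{i,j} x_j` for a matrix `M`. -/
noncomputable def actQ {m : ℕ} (M : Matrix (Fin m) (Fin m) ℚ) :
    MvPolynomial (Fin m) ℚ →ₐ[ℚ] MvPolynomial (Fin m) ℚ :=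
  aeval fun i => ∑ j, C (M i j) * X j

/-- For a subring `R ⊆ ℚ` and a subgroup `G ⊆ GL_m(ℚ)`, the invariant ring `R[x_1, …, x_m]^G`:
the `R`-subalgebra of `ℚ[x_1, …, x_m]` consisting of the polynomials with all coefficients
in `R` that are fixed by the substitution action of every element of `G`. -/
noncomputable def invariantRingQ {m : ℕ} (R : Subring ℚ) (G : Subgroup (GL (Fin m) ℚ)) :
    Subalgebra ↥R (MvPolynomial (Fin m) ℚ) :=
  (MvPolynomial.mapAlgHom (R := ↥R) (σ := Fin m) (Algebra.ofId ↥R ℚ)).range ⊓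
    Subalgebra.restrictScalars ↥R
      (⨅ g ∈ G, AlgHom.equalizer (actQ (g : Matrix (Fin m) (Fin m) ℚ)) (AlgHom.id ℚ _))

/-- `R[x_1, …, x_m]^G` is isomorphic to a polynomial ring over `R`. -/
def IsPolynomialRingQ {m : ℕ} (R : Subring ℚ) (G : Subgroup (GL (Fin m) ℚ)) : Prop :=
  ∃ k : ℕ, Nonempty (↥(invariantRingQ R G) ≃ₐ[↥R] MvPolynomial (Fin k) ↥R)

/-- For a subgroup `G ⊆ GL_m(ℚ)`, the invariant ring `ℤ[x_1, …, x_m]^G`: the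
`ℤ`-subalgebra of `ℚ[x_1, …, x_m]` consisting of the polynomials with all coefficients
in `ℤ` that are fixed by the substitution action of every element of `G`. -/
noncomputable def invariantRingZ {m : ℕ} (G : Subgroup (GL (Fin m) ℚ)) :
    Subalgebra ℤ (MvPolynomial (Fin m) ℚ) :=
  (MvPolynomial.mapAlgHom (R := ℤ) (σ := Fin m) (Algebra.ofId ℤ ℚ)).range ⊓
    Subalgebra.restrictScalars ℤ
      (⨅ g ∈ G, AlgHom.equalizer (actQ (g : Matrix (Fin m) (Fin m) ℚ)) (AlgHom.id ℚ _))

noncomputable def xP : MvPolynomial (Fin (4 - 1)) ℚ := X ⟨0, by omega⟩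
noncomputable def yP : MvPolynomial (Fin (4 - 1)) ℚ := X ⟨1, by omega⟩
noncomputable def zP : MvPolynomial (Fin (4 - 1)) ℚ := X ⟨2, by omega⟩

noncomputable def fP : MvPolynomial (Fin (4 - 1)) ℚ :=
  6*xP^2 + 8*xP*yP + 3*yP^2 + 4*xP*zP + 3*yP*zP + zP^2
noncomputable def gP : MvPolynomial (Fin (4 - 1)) ℚ :=
  8*xP^3 + 16*xP^2*yP + 10*xP*yP^2 + 2*yP^3 + 8*xP^2*zP + 10*xP*yP*zP + 3*yP^2*zP
    + 2*xP*zP^2 + yP*zP^2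
noncomputable def hP : MvPolynomial (Fin (4 - 1)) ℚ :=
  3*xP^4 + 8*xP^3*yP + 7*xP^2*yP^2 + 2*xP*yP^3 + 4*xP^3*zP + 7*xP^2*yP*zP + 3*xP*yP^2*zP
    + xP^2*zP^2 + xP*yP*zP^2


theorem actQ_comp {m : ℕ} (M N : Matrix (Fin m) (Fin m) ℚ) (p : MvPolynomial (Fin m) ℚ) :
    actQ M (actQ N p) = actQ (N * M) p := by
  rw [← AlgHom.comp_apply]
  congr 1
  ext1 i
  simp only [actQ, AlgHom.comp_apply, aeval_X, map_sum, map_mul, algHom_C, algebraMap_eq,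
    Matrix.mul_apply, Finset.sum_mul, Finset.mul_sum, mul_assoc]
  exact Finset.sum_comm

theorem actQ_one {m : ℕ} : actQ (1 : Matrix (Fin m) (Fin m) ℚ) = AlgHom.id ℚ _ := by
  ext1 i
  simp [actQ, Matrix.one_apply]

/-- The matrices `V₄⁻¹ F_k V₄` for `n = 4`, computed explicitly. -/
def craigMat : Fin 3 → Matrix (Fin 3) (Fin 3) ℚ :=
  ![!![1, 0, 0; 0, 1, 1; 0, 0, -1], !![1, 1, 0; 0, -1, 0; 0, 1, 1],
    !![-3, -2, -1; 4, 3, 1; 0, 0, 1]]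

theorem Vmat_four_four : Vmat 4 4 = !![4, 2, 1; 0, 1, 0; 0, 0, 1] := by
  ext i j
  fin_cases i <;> fin_cases j <;> simp [Vmat, Emat, Finset.sum_Icc_succ_top]

theorem Vmat_inv_mul_Fmat_mul_Vmat (k : Fin 3) :
    (Vmat 4 4)⁻¹ * Fmat 4 (k + 1) * Vmat 4 4 = craigMat k := by
  have hdet : IsUnit (Vmat 4 4).det := by
    rw [Vmat_four_four]
    simp [Matrix.det_fin_three]
  have h : Fmat 4 (k + 1) * Vmat 4 4 = Vmat 4 4 * craigMat k := by
    rw [Vmat_four_four]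
    ext i j
    fin_cases k <;> fin_cases i <;> fin_cases j <;>
      simp [Fmat, Emat, craigMat, Matrix.mul_apply, Fin.sum_univ_three, Matrix.one_apply] <;>
      norm_num
  rw [Matrix.mul_assoc, h, Matrix.nonsing_inv_mul_cancel_left _ _ hdet]

theorem craigMat_mul_self (k : Fin 3) : craigMat k * craigMat k = 1 := by
  fin_cases k <;> ext i j <;> fin_cases i <;> fin_cases j <;>
    simp [craigMat, Matrix.mul_apply, Fin.sum_univ_three] <;> norm_num

theorem mem_iInf_equalizer_iff {p : MvPolynomial (Fin (4 - 1)) ℚ} :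
    (p ∈ ⨅ g ∈ craigGroup 4 4,
      AlgHom.equalizer (actQ (g : Matrix (Fin (4 - 1)) (Fin (4 - 1)) ℚ)) (AlgHom.id ℚ _)) ↔
      ∀ k, actQ (craigMat k) p = p := by
  simp only [Algebra.mem_iInf, AlgHom.mem_equalizer, AlgHom.id_apply]
  constructor
  · intro h k
    refine h ⟨craigMat k, craigMat k, craigMat_mul_self k, craigMat_mul_self k⟩
      (Subgroup.subset_closure ⟨k + 1, by omega, by omega, ?_⟩)
    exact (Vmat_inv_mul_Fmat_mul_Vmat k).symm
  · intro h g hg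
    induction hg using Subgroup.closure_induction with
    | mem g hg =>
      obtain ⟨k, hk1, hk2, hk⟩ := hg
      obtain ⟨k, rfl⟩ : ∃ j : Fin 3, k = j + 1 := ⟨⟨k - 1, by omega⟩, by simp; omega⟩
      rw [hk, Vmat_inv_mul_Fmat_mul_Vmat]
      exact h k
    | one => rw [Units.val_one, actQ_one, AlgHom.id_apply]
    | mul a b _ _ ha hb => rw [Units.val_mul, ← actQ_comp, ha, hb]
    | inv a _ ha =>
      conv_lhs => rw [← ha]
      rw [actQ_comp, ← Units.val_mul, mul_inv_cancel, Units.val_one, actQ_one, AlgHom.id_apply]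

/-- Four linear forms with sum zero permuted by the group. -/
noncomputable def rootForm : Fin 4 → MvPolynomial (Fin 3) ℚ :=
  ![X 0, X 0 + X 1, X 0 + X 1 + X 2, -(3 * X 0 + 2 * X 1 + X 2)]

theorem actQ_craigMat_rootForm (k : Fin 3) (i : Fin 4) :
    actQ (craigMat k) (rootForm i) =
      rootForm ((![Equiv.swap 1 2, Equiv.swap 0 1, Equiv.swap 0 3] :
        Fin 3 → Equiv.Perm (Fin 4)) k i) := by
  have hX (j : Fin 3) : actQ (craigMat k) (X j) = ∑ l, C (craigMat k j l) * X l := aeval_X _ _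
  have hC (n : ℕ) [n.AtLeastTwo] : (C (OfNat.ofNat n : ℚ) : MvPolynomial (Fin 3) ℚ) =
    OfNat.ofNat n := map_ofNat _ _
  have h0 := hX 0
  have h1 := hX 1
  have h2 := hX 2
  clear hX
  rw [Fin.sum_univ_three] at h0 h1 h2
  have h3 : actQ (craigMat k) 2 = 2 := map_ofNat _ 2
  have h4 : actQ (craigMat k) 3 = 3 := map_ofNat _ 3
  generalize actQ (craigMat k) = A at *
  fin_cases k <;> simp [craigMat, hC] at h0 h1 h2 h3 h4 <;> fin_cases i <;>
    simp [rootForm, Equiv.swap_apply_def, h0, h1, h2, h3, h4] <;> ring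

theorem fP_eq : fP = rootForm 0 ^ 2 + rootForm 1 ^ 2 + rootForm 2 ^ 2 + rootForm 0 * rootForm 1
    + rootForm 0 * rootForm 2 + rootForm 1 * rootForm 2 := by
  simp [fP, rootForm, xP, yP, zP]
  ring

theorem gP_eq : gP = -(rootForm 0 * rootForm 1 * rootForm 2 + rootForm 3 *
    (rootForm 0 * rootForm 1 + rootForm 0 * rootForm 2 + rootForm 1 * rootForm 2)) := by
  simp [gP, rootForm, xP, yP, zP]
  ring

theorem hP_eq : hP = -(rootForm 0 * rootForm 1 * rootForm 2 * rootForm 3) := by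
  simp [hP, rootForm, xP, yP, zP]
  ring

theorem rootForm_three : rootForm 3 = -(rootForm 0 + rootForm 1 + rootForm 2) := by
  simp [rootForm]
  ring

theorem rootForm_injective : Function.Injective rootForm := by
  have h : (aeval ![(1 : ℚ), 1, 1] : MvPolynomial (Fin 3) ℚ →ₐ[ℚ] ℚ) ∘ rootForm =
      ![1, 2, 3, -6] := by
    ext i
    fin_cases i <;> simp [rootForm] <;> norm_num
  refine Function.Injective.of_comp (f := (aeval ![(1 : ℚ), 1, 1])) (h ▸ ?_)
  intro i j
  fin_cases i <;> fin_cases j <;> simp <;> norm_num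

theorem actQ_fP_gP_hP (k : Fin 3) : actQ (craigMat k) fP = fP ∧ actQ (craigMat k) gP = gP ∧
    actQ (craigMat k) hP = hP := by
  have h := actQ_craigMat_rootForm k
  rw [fP_eq, gP_eq, hP_eq]
  simp only [map_add, map_mul, map_pow, map_neg, h]
  fin_cases k <;> simp [Equiv.swap_apply_def, rootForm_three, -mul_eq_mul_left_iff, -mul_eq_mul_right_iff] <;>
    refine ⟨?_, ?_, ?_⟩ <;> ring

theorem actQ_eq_self_of_mem_adjoin {b : MvPolynomial (Fin 3) ℚ}
    (hb : b ∈ Algebra.adjoin ℤ {fP, gP, hP}) (k : Fin 3) : actQ (craigMat k) b = b := by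
  have : Algebra.adjoin ℤ {fP, gP, hP} ≤
      (AlgHom.equalizer (actQ (craigMat k)) (AlgHom.id ℚ _)).restrictScalars ℤ := by
    refine Algebra.adjoin_le ?_
    rintro p (rfl | rfl | rfl)
    · exact (actQ_fP_gP_hP k).1
    · exact (actQ_fP_gP_hP k).2.1
    · exact (actQ_fP_gP_hP k).2.2
  exact this hb

theorem adjoin_le_range_map : Algebra.adjoin ℤ {fP, gP, hP} ≤
    (MvPolynomial.mapAlgHom (R := ℤ) (σ := Fin 3) (Algebra.ofId ℤ ℚ)).range := by
  have h (i : Fin 4) : rootForm i ∈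
      (MvPolynomial.mapAlgHom (R := ℤ) (σ := Fin 3) (Algebra.ofId ℤ ℚ)).range := by
    refine ⟨(![X 0, X 0 + X 1, X 0 + X 1 + X 2, -(3 * X 0 + 2 * X 1 + X 2)] :
      Fin 4 → MvPolynomial (Fin 3) ℤ) i, ?_⟩
    fin_cases i <;> simp [rootForm]
  refine Algebra.adjoin_le ?_
  rintro p (rfl | rfl | rfl)
  · rw [fP_eq]
    repeat first | exact h _ | apply add_mem | apply neg_mem | apply pow_mem | apply mul_mem
  · rw [gP_eq]
    repeat first | exact h _ | apply add_mem | apply neg_mem | apply pow_mem | apply mul_mem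
  · rw [hP_eq]
    repeat first | exact h _ | apply add_mem | apply neg_mem | apply pow_mem | apply mul_mem

theorem isSymmetric_of_rename_swap {R : Type*} [CommSemiring R] {n : ℕ}
    {p : MvPolynomial (Fin (n + 1)) R}
    (h : ∀ i : Fin n, rename (Equiv.swap i.castSucc i.succ) p = p) : p.IsSymmetric := by
  intro e
  have he : e ∈ Submonoid.closure
      (Set.range fun i : Fin n => Equiv.swap i.castSucc i.succ) := by
    rw [Equiv.Perm.mclosure_swap_castSucc_succ]
    trivial
  induction he using Submonoid.closure_induction with
  | mem e he =>
    obtain ⟨i, rfl⟩ := he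
    exact h i
  | one => simp
  | mul a b _ _ ha hb => rw [Equiv.Perm.coe_mul, ← rename_rename, hb, ha]

/-- The substitution of the first three linear forms. -/
noncomputable def rootSubst : MvPolynomial (Fin 3) ℤ →ₐ[ℤ] MvPolynomial (Fin 3) ℚ :=
  aeval ![rootForm 0, rootForm 1, rootForm 2]

theorem rootSubst_injective : Function.Injective rootSubst := by
  have h : ((aeval ![X 0, X 1 - X 0, X 2 - X 1] : MvPolynomial (Fin 3) ℚ →ₐ[ℚ]
      MvPolynomial (Fin 3) ℚ).restrictScalars ℤ).comp rootSubst =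
      MvPolynomial.mapAlgHom (Algebra.ofId ℤ ℚ) := by
    ext1 i
    fin_cases i <;> simp [rootSubst, rootForm, aeval_X]
  refine Function.Injective.of_comp (f := (aeval ![X 0, X 1 - X 0, X 2 - X 1] :
    MvPolynomial (Fin 3) ℚ →ₐ[ℚ] MvPolynomial (Fin 3) ℚ)) ?_
  have h' := congrArg DFunLike.coe h
  rw [AlgHom.coe_comp] at h'
  refine h' ▸ map_injective _ (RingHom.injective_int _)

theorem range_map_le_range_rootSubst :
    (MvPolynomial.mapAlgHom (R := ℤ) (σ := Fin 3) (Algebra.ofId ℤ ℚ)).range ≤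
      rootSubst.range := by
  have h : rootSubst.comp (aeval ![X 0, X 1 - X 0, X 2 - X 1]) =
      MvPolynomial.mapAlgHom (Algebra.ofId ℤ ℚ) := by
    ext1 i
    fin_cases i <;> simp [rootSubst, rootForm, aeval_X]
  rw [← h]
  exact AlgHom.range_comp_le_range _ _

theorem rootSubst_rename_swap (i : Fin 2) (P : MvPolynomial (Fin 3) ℤ) :
    rootSubst (rename (Equiv.swap i.castSucc i.succ) P) =
      actQ (craigMat (![1, 0] i)) (rootSubst P) := by
  have h : rootSubst.comp (rename (Equiv.swap i.castSucc i.succ)) =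
      ((actQ (craigMat (![1, 0] i))).restrictScalars ℤ).comp rootSubst := by
    ext1 j
    fin_cases i <;> fin_cases j <;>
      simp [rootSubst, aeval_X, actQ_craigMat_rootForm, Equiv.swap_apply_def]
  exact DFunLike.congr_fun h P

theorem mem_adjoin_of_isSymmetric {P : MvPolynomial (Fin 3) ℤ} (hsymm : P.IsSymmetric) :
    P ∈ Algebra.adjoin ℤ {X 0 + X 1 + X 2, X 0 * X 1 + X 0 * X 2 + X 1 * X 2,
      (X 0 * X 1 * X 2 : MvPolynomial (Fin 3) ℤ)} := by
  obtain ⟨Q, hQ⟩ := esymmAlgHom_surjective (σ := Fin 3) ℤ (n := 3) (by simp) ⟨P, hsymm⟩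
  have h1 : esymm (Fin 3) ℤ 1 = X 0 + X 1 + X 2 := by
    simp [esymm_one, Fin.sum_univ_three]
  have h2 : esymm (Fin 3) ℤ 2 = X 0 * X 1 + X 0 * X 2 + X 1 * X 2 := by
    have : Finset.powersetCard 2 (Finset.univ : Finset (Fin 3)) = {{0, 1}, {0, 2}, {1, 2}} := by
      decide
    rw [esymm, this, Finset.sum_insert (by decide), Finset.sum_insert (by decide),
      Finset.sum_singleton, ← add_assoc]
    simp [Finset.prod_insert]
  have h3 : esymm (Fin 3) ℤ 3 = X 0 * X 1 * X 2 := by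
    have : Finset.powersetCard 3 (Finset.univ : Finset (Fin 3)) = {Finset.univ} := by
      decide
    rw [esymm, this, Finset.sum_singleton, Fin.prod_univ_three]
  have hPQ : P = aeval (fun i : Fin 3 ↦ esymm (Fin 3) ℤ (i + 1)) Q := by
    rw [← esymmAlgHom_apply, hQ]
  have hmem : P ∈ Algebra.adjoin ℤ (Set.range fun i : Fin 3 ↦ esymm (Fin 3) ℤ (i + 1)) := by
    rw [Algebra.adjoin_range_eq_range_aeval, hPQ]
    exact ⟨Q, rfl⟩
  refine Algebra.adjoin_mono ?_ hmem
  rintro _ ⟨i, rfl⟩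
  fin_cases i <;> simp [h1, h2, h3]

theorem exists_eq_cubic_of_mem_adjoin {A : Type*} [CommRing A] {B : Subalgebra ℤ A} (f g h : B)
    {u : A} (hu : u ^ 4 = f * u ^ 2 - g * u + h) {s : Set A}
    (hs : ∀ x ∈ s, ∃ a b c d : B, x = a + b * u + c * u ^ 2 + d * u ^ 3) {p : A}
    (hp : p ∈ Algebra.adjoin ℤ s) :
    ∃ a b c d : B, p = a + b * u + c * u ^ 2 + d * u ^ 3 := by
  induction hp using Algebra.adjoin_induction with
  | mem x hx => exact hs x hx
  | algebraMap r => exact ⟨algebraMap ℤ B r, 0, 0, 0, by simp⟩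
  | add x y _ _ hx hy =>
    obtain ⟨a, b, c, d, rfl⟩ := hx
    obtain ⟨a', b', c', d', rfl⟩ := hy
    exact ⟨a + a', b + b', c + c', d + d', by push_cast; ring⟩
  | mul x y _ _ hx hy =>
    obtain ⟨a, b, c, d, rfl⟩ := hx
    obtain ⟨a', b', c', d', rfl⟩ := hy
    refine ⟨a * a' + h * (b * d' + c * c' + d * b') + f * h * (d * d'),
      a * b' + b * a' - g * (b * d' + c * c' + d * b') + h * (c * d' + d * c') - f * g * (d * d'),
      a * c' + b * b' + c * a' + f * (b * d' + c * c' + d * b') - g * (c * d' + d * c')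
        + (f ^ 2 + h) * (d * d'),
      a * d' + b * c' + c * b' + d * a' + f * (c * d' + d * c') - g * (d * d'), ?_⟩
    push_cast
    linear_combination ((b * d' + c * c' + d * b' : A) + (c * d' + d * c') * u
      + d * d' * (u ^ 2 + f)) * hu

theorem exists_eq_cubic_of_isSymmetric {P : MvPolynomial (Fin 3) ℤ} (hsymm : P.IsSymmetric) :
    ∃ a b c d : Algebra.adjoin ℤ {fP, gP, hP}, rootSubst P = a + b * rootForm 3
      + c * rootForm 3 ^ 2 + d * rootForm 3 ^ 3 := by
  have hmem : rootSubst P ∈ (Algebra.adjoin ℤ _).map rootSubst :=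
    ⟨P, mem_adjoin_of_isSymmetric hsymm, rfl⟩
  rw [AlgHom.map_adjoin] at hmem
  let f : Algebra.adjoin ℤ {fP, gP, hP} := ⟨fP, Algebra.subset_adjoin (by simp)⟩
  let g : Algebra.adjoin ℤ {fP, gP, hP} := ⟨gP, Algebra.subset_adjoin (by simp)⟩
  let h : Algebra.adjoin ℤ {fP, gP, hP} := ⟨hP, Algebra.subset_adjoin (by simp)⟩
  have hneg : ((-1 : Algebra.adjoin ℤ {fP, gP, hP}) : MvPolynomial (Fin 3) ℚ) = -1 := rfl
  refine exists_eq_cubic_of_mem_adjoin f g h ?_ ?_ hmem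
  · simp only [f, g, h, fP_eq, gP_eq, hP_eq, rootForm_three]
    ring
  · rintro _ ⟨x, rfl | rfl | rfl, rfl⟩
    · refine ⟨0, -1, 0, 0, ?_⟩
      simp [rootSubst, aeval_X, rootForm_three, hneg]
    · refine ⟨-f, 0, 1, 0, ?_⟩
      simp [rootSubst, aeval_X, rootForm_three, f, fP_eq]
      ring
    · refine ⟨-g, f, 0, -1, ?_⟩
      simp [rootSubst, aeval_X, rootForm_three, hneg, f, g, fP_eq, gP_eq]
      ring

theorem mem_adjoin_of_invariant {p : MvPolynomial (Fin 3) ℚ}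
    (hp : p ∈ (MvPolynomial.mapAlgHom (R := ℤ) (σ := Fin 3) (Algebra.ofId ℤ ℚ)).range)
    (hinv : ∀ k, actQ (craigMat k) p = p) : p ∈ Algebra.adjoin ℤ {fP, gP, hP} := by
  obtain ⟨P, rfl⟩ := range_map_le_range_rootSubst hp
  change ∀ k, actQ (craigMat k) (rootSubst P) = rootSubst P at hinv
  change rootSubst P ∈ _
  have hsymm : P.IsSymmetric := isSymmetric_of_rename_swap fun i =>
    rootSubst_injective (by rw [rootSubst_rename_swap, hinv])
  obtain ⟨a, b, c, d, h3⟩ := exists_eq_cubic_of_isSymmetric hsymm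
  have step {i j : Fin 4} (k : Fin 3) (hij : actQ (craigMat k) (rootForm i) = rootForm j)
      (h : rootSubst P = a + b * rootForm i + c * rootForm i ^ 2 + d * rootForm i ^ 3) :
      rootSubst P = a + b * rootForm j + c * rootForm j ^ 2 + d * rootForm j ^ 3 := by
    have := congrArg (actQ (craigMat k)) h
    simpa only [hinv, map_add, map_mul, map_pow, hij,
      actQ_eq_self_of_mem_adjoin (SetLike.coe_mem _)] using this
  have h0 := step 2 (j := 0) (actQ_craigMat_rootForm 2 3) h3
  have h1 := step 1 (j := 1) (actQ_craigMat_rootForm 1 0) h0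
  have h2 := step 0 (j := 2) (actQ_craigMat_rootForm 0 1) h1
  have hv : ![(a : MvPolynomial (Fin 3) ℚ) - rootSubst P, b, c, d] = 0 := by
    refine Matrix.eq_zero_of_forall_index_sum_mul_pow_eq_zero rootForm_injective fun j => ?_
    fin_cases j <;> simp [Fin.sum_univ_four]
    · linear_combination -h0
    · linear_combination -h1
    · linear_combination -h2
    · linear_combination -h3
  rw [← sub_eq_zero.mp (congrFun hv 0)]
  exact a.2

theorem exists_roots_quartic {K : Type*} [Field K] [IsAlgClosed K] [CharZero K] (a b c : K) :
    ∃ r s t u : K, r + s + t + u = 0 ∧ r * s + r * t + r * u + s * t + s * u + t * u = -a ∧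
      r * s * t + r * s * u + r * t * u + s * t * u = -b ∧ r * s * t * u = -c := by
  let q : Polynomial K := .X ^ 4 - .C a * .X ^ 2 + .C b * .X - .C c
  have hdeg : q.natDegree = 4 := by
    unfold q
    compute_degree!
  have hmonic : q.Monic := by
    unfold q
    monicity!
  have hs : q.Splits := IsAlgClosed.splits q
  have hcard : q.roots.card = 4 := by
    rw [← hs.natDegree_eq_card_roots, hdeg]
  obtain ⟨r, s, t, u, hr⟩ := Multiset.card_eq_four.mp hcard
  have heval (x : K) : x ^ 4 - a * x ^ 2 + b * x - c =
      (x - r) * (x - s) * (x - t) * (x - u) := by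
    have := congrArg (Polynomial.eval x) (hs.eq_prod_roots_of_monic hmonic)
    rw [hr] at this
    simpa [q, mul_assoc] using this
  have e0 := heval 0
  have e1 := heval 1
  have e2 := heval (-1)
  have e3 := heval 2
  have hsum : r + s + t + u = 0 := by
    linear_combination e3 / 6 - e1 / 2 - e2 / 6 + e0 / 2
  refine ⟨r, s, t, u, hsum, ?_, ?_, ?_⟩
  · linear_combination -(e1 + e2) / 2 + e0
  · linear_combination (e1 - e2) / 2 - hsum
  · linear_combination -e0

theorem algebraicIndependent_fP_gP_hP : AlgebraicIndependent ℤ ![fP, gP, hP] := by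
  rw [algebraicIndependent_iff]
  intro p hp
  refine map_injective (Int.castRingHom ℂ) Int.cast_injective ?_
  rw [map_zero]
  refine MvPolynomial.funext fun a => ?_
  obtain ⟨r, s, t, u, h1, h2, h3, h4⟩ := exists_roots_quartic (a 0) (a 1) (a 2)
  let ev : MvPolynomial (Fin 3) ℚ →ₐ[ℤ] ℂ :=
    (aeval (R := ℚ) ![r, s - r, t - s]).restrictScalars ℤ
  have hr : ∀ i, ev (rootForm i) = ![r, s, t, u] i := by
    intro i
    fin_cases i <;> simp [ev, rootForm, aeval_X]
    linear_combination -h1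
  have hev : (fun i => ev (![fP, gP, hP] i)) = a := by
    ext i
    fin_cases i
    · simp [fP_eq, hr]
      linear_combination -h2 + (r + s + t) * h1
    · simp [gP_eq, hr]
      linear_combination -h3
    · simp [hP_eq, hr]
      linear_combination -h4
  have := congrArg ev hp
  rw [map_zero, ← AlgHom.comp_apply, comp_aeval, hev] at this
  rw [eval_map, map_zero, ← this]
  rfl

/-- for Craig's representation `L_4` of `S_4` (the case `n = 4`, `d = 4`),
`ℤ[L_4]^{S_4} = ℤ[f, g, h]` is a polynomial ring, with `f`, `g`, `h` as given and
algebraically independent over `ℤ`. -/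
theorem craig_L4_S4_invariants :
    invariantRingZ (craigGroup 4 4) = Algebra.adjoin ℤ {fP, gP, hP} ∧
    AlgebraicIndependent ℤ ![fP, gP, hP] ∧
    ∃ k : ℕ, Nonempty (↥(invariantRingZ (craigGroup 4 4)) ≃ₐ[ℤ] MvPolynomial (Fin k) ℤ) := by
  have heq : invariantRingZ (craigGroup 4 4) = Algebra.adjoin ℤ {fP, gP, hP} := by
    refine le_antisymm (fun p hp => ?_) fun p hp => ?_
    · exact mem_adjoin_of_invariant hp.1 (mem_iInf_equalizer_iff.mp hp.2)
    · exact ⟨adjoin_le_range_map hp,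
        mem_iInf_equalizer_iff.mpr (actQ_eq_self_of_mem_adjoin hp)⟩
  refine ⟨heq, algebraicIndependent_fP_gP_hP, 3, ⟨?_⟩⟩
  have hrange : Set.range ![fP, gP, hP] = {fP, gP, hP} := by
    rw [Matrix.range_cons, Matrix.range_cons_cons_empty, Set.singleton_union]
  exact (Subalgebra.equivOfEq _ _ (heq.trans (by rw [hrange]))).trans
    algebraicIndependent_fP_gP_hP.aevalEquiv.symm
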